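/- arXiv:2403.06864 — 5 statements merged into one kernel-verified Lean document; each statement's English description precedes it below -/
import Mathlib

section
/- Let T be an invertible measure-preserving transformation of a σ-finite measure space (Y, m) with m ≠ 0, let p ≥ 2, and let F : Y × ZMod p → Y × ZMod p be defined by F(x, z) = (T x, z + 1) if z = 0 and F(x, z) = (x, z + 1) if z ≠ 0, preserving μ = m × ν with ν the uniform probability measure on ZMod p. If T is ergodic with respect to m, then for each i ∈ ZMod p the set Y × {i} is invariant under F^p and F^p is ergodic with respect to the restricted measure μ restricted to Y × {i}. -/
open MeasureTheory Filter
open scoped symmDiff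

/-- Ergodicity of a measure-preserving map, with invariance understood up to null sets. -/
def ErgodicAE {X : Type*} [MeasurableSpace X] (f : X → X) (μ : Measure X) : Prop :=
  ∀ A : Set X, MeasurableSet A → μ ((f ⁻¹' A) ∆ A) = 0 → μ A = 0 ∨ μ Aᶜ = 0

/-- The skew transformation `F(x, z) = (T x, z + 1)` for `z = 0` and
`F(x, z) = (x, z + 1)` for `z ≠ 0` on `Y × ZMod p`. -/
def cyc {Y : Type*} (p : ℕ) (T : Y → Y) : Y × ZMod p → Y × ZMod p :=
  fun xz => if xz.2 = 0 then (T xz.1, xz.2 + 1) else (xz.1, xz.2 + 1)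

/-- The uniform probability measure on `ZMod p`. -/
noncomputable def unif (p : ℕ) : Measure (ZMod p) := (p : ENNReal)⁻¹ • Measure.count

/-- Iterates of `cyc` apply `T` once for every visit of the cyclic coordinate to `0`. -/
theorem cyc_iterate_apply {Y : Type*} (p : ℕ) (T : Y → Y) (n : ℕ) (y : Y) (z : ZMod p) :
    (cyc p T)^[n] (y, z) = (T^[Nat.count (fun j : ℕ => z + j = 0) n] y, z + n) := by
  induction n with
  | zero => simp
  | succ n ih =>
    rw [Function.iterate_succ_apply', ih, Nat.count_succ]
    by_cases h : z + (n : ZMod p) = 0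
    · simp only [cyc, h, if_true, Function.iterate_succ_apply', Nat.cast_succ, ← add_assoc]
    · simp only [cyc, h, if_false, add_zero, Nat.cast_succ, add_assoc]

/-- Each residue class visits `0` exactly once in `p` consecutive unit steps. -/
theorem count_add_natCast_eq_zero (p : ℕ) [NeZero p] (z : ZMod p) :
    Nat.count (fun j : ℕ => z + j = 0) p = 1 := by
  rw [Nat.count_eq_card_filter_range, Finset.card_eq_one]
  refine ⟨(-z).val, ?_⟩
  ext j
  simp only [Finset.mem_filter, Finset.mem_range, Finset.mem_singleton]
  constructor
  · rintro ⟨hj, h⟩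
    rw [neg_eq_of_add_eq_zero_right h, ZMod.val_natCast_of_lt hj]
  · rintro rfl
    exact ⟨ZMod.val_lt _, by simp⟩

theorem cyc_iterate_self_apply {Y : Type*} (p : ℕ) [NeZero p] (T : Y → Y) (x : Y × ZMod p) :
    (cyc p T)^[p] x = (T x.1, x.2) := by
  rw [← Prod.mk.eta (p := x), cyc_iterate_apply, count_add_natCast_eq_zero]
  simp

instance unif.instIsFiniteMeasure (p : ℕ) [NeZero p] : IsFiniteMeasure (unif p) :=
  ⟨by simp [unif, ENNReal.mul_lt_top, pos_iff_ne_zero, NeZero.ne p]⟩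

theorem unif_singleton_ne_zero (p : ℕ) (i : ZMod p) : unif p {i} ≠ 0 := by
  simp [unif]

/-- A set is null on the fibre over `i` exactly when its section at `i` is null. -/
theorem prod_unif_restrict_eq_zero_iff {Y : Type*} [MeasurableSpace Y] (m : Measure Y)
    (p : ℕ) [NeZero p] (i : ZMod p) (A : Set (Y × ZMod p)) :
    (m.prod (unif p)).restrict (Set.univ ×ˢ ({i} : Set (ZMod p))) A = 0 ↔
      m ((fun y => (y, i)) ⁻¹' A) = 0 := by
  have h : A ∩ Set.univ ×ˢ ({i} : Set (ZMod p)) = ((fun y => (y, i)) ⁻¹' A) ×ˢ {i} := by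
    ext ⟨y, z⟩
    simp only [Set.mem_inter_iff, Set.mem_prod, Set.mem_univ, Set.mem_singleton_iff, true_and,
      Set.mem_preimage]
    constructor <;> rintro ⟨h, rfl⟩ <;> exact ⟨h, rfl⟩
  rw [Measure.restrict_apply' (MeasurableSet.univ.prod (measurableSet_singleton i)), h,
    Measure.prod_prod, mul_eq_zero, or_iff_left (unif_singleton_ne_zero p i)]

/-- if `T` is ergodic then each set `Y × {i}` is invariant under `F^p`
and `F^p` is ergodic on it. -/
theorem stmt4
    {Y : Type*} [MeasurableSpace Y] {m : Measure Y} [SigmaFinite m] (hm : m ≠ 0)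
    (T : Y ≃ᵐ Y) (hT : MeasurePreserving T m m) (hTerg : ErgodicAE T m)
    (p : ℕ) (hp : 2 ≤ p) (i : ZMod p) :
    (cyc p T)^[p] ⁻¹' (Set.univ ×ˢ ({i} : Set (ZMod p))) = Set.univ ×ˢ ({i} : Set (ZMod p)) ∧
    ErgodicAE ((cyc p T)^[p])
      ((m.prod (unif p)).restrict (Set.univ ×ˢ ({i} : Set (ZMod p)))) := by
  have : NeZero p := ⟨by omega⟩
  have hF : (cyc p T)^[p] = fun x => (T x.1, x.2) := funext (cyc_iterate_self_apply p T)
  rw [hF]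
  refine ⟨by ext; simp, fun A hA hinv => ?_⟩
  rw [prod_unif_restrict_eq_zero_iff] at hinv ⊢
  rw [prod_unif_restrict_eq_zero_iff]
  exact hTerg _ (measurable_prodMk_right hA) hinv
end

section
/- (Lemma 1) Let T be an ergodic invertible measure-preserving transformation of a σ-finite measure space (Y, m) with m ≠ 0, let p ≥ 2, and let F : Y × ZMod p → Y × ZMod p be defined by F(x, z) = (T x, z + 1) if z = 0 and F(x, z) = (x, z + 1) if z ≠ 0, preserving μ = m × ν with ν the uniform probability measure on ZMod p. Then F has no p-th root: there is no invertible measure-preserving transformation R of (Y × ZMod p, μ) whose p-fold iterate R^p equals F μ-almost everywhere. -/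
open MeasureTheory Filter
open scoped symmDiff

theorem snd_cyc {Y : Type*} (p : ℕ) (T : Y → Y) (x : Y × ZMod p) :
    (cyc p T x).2 = x.2 + 1 := by
  unfold cyc
  split_ifs <;> rfl

theorem forall_of_ae_unif {p : ℕ} {P : ZMod p → Prop} (h : ∀ᵐ z ∂unif p, P z) (z : ZMod p) :
    P z := by
  rw [unif, Measure.ae_ennreal_smul_measure_iff (by simp), Measure.ae_count_iff] at h
  exact h z

/-- Almost everywhere for `m.prod (unif p)` means on almost every whole fibre `{y} × ZMod p`. -/
theorem ae_prod_unif_iff {Y : Type*} [MeasurableSpace Y] {m : Measure Y} [SigmaFinite m]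
    {p : ℕ} [NeZero p] {P : Y × ZMod p → Prop} :
    (∀ᵐ x ∂m.prod (unif p), P x) ↔ ∀ᵐ y ∂m, ∀ z, P (y, z) := by
  have : IsFiniteMeasure (unif p) := by
    unfold unif
    exact Measure.smul_finite _ (by simp [NeZero.ne p])
  constructor
  · intro h
    filter_upwards [Measure.ae_ae_of_ae_prod h] with y hy
    exact forall_of_ae_unif hy
  · intro h
    filter_upwards [Measure.quasiMeasurePreserving_fst.ae h] with x hx
    exact hx x.2

theorem eq_of_forall_ne_zero_add_one {p : ℕ} [NeZero p] {α : Type*} {g : ZMod p → α}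
    (h : ∀ z, z ≠ 0 → g (z + 1) = g z) (z : ZMod p) : g z = g 1 := by
  have key : ∀ k : ℕ, k < p → g ((k : ZMod p) + 1) = g 1 := by
    intro k
    induction k with
    | zero => simp
    | succ k ih =>
      intro hk
      rw [h _ ?_, Nat.cast_succ, ih (by omega)]
      rw [Ne, ZMod.natCast_eq_zero_iff]
      exact Nat.not_dvd_of_pos_of_lt k.succ_pos hk
  simpa using key (z - 1).val (ZMod.val_lt _)

/-- An almost everywhere invariant function with countably many values is almost everywhere
constant. -/
theorem ErgodicAE.exists_ae_eq_const {X α : Type*} [MeasurableSpace X] {μ : Measure X}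
    (hμ : μ ≠ 0) {f : X → X} (hf : ErgodicAE f μ) [Countable α] [MeasurableSpace α]
    [MeasurableSingletonClass α] {g : X → α} (hg : Measurable g)
    (hinv : ∀ᵐ x ∂μ, g (f x) = g x) : ∃ c, ∀ᵐ x ∂μ, g x = c := by
  by_contra hne
  rw [not_exists] at hne
  have hnull : ∀ c, μ (g ⁻¹' {c}) = 0 := by
    intro c
    refine (hf (g ⁻¹' {c}) (hg (measurableSet_singleton c)) ?_).resolve_right (hne c)
    rw [measure_symmDiff_eq_zero_iff]
    filter_upwards [hinv] with x hx
    change (g (f x) = c) = (g x = c)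
    rw [hx]
  have hall : ∀ᵐ x ∂μ, ∀ c, g x ≠ c := ae_all_iff.2 fun c => by
    simpa [ae_iff, Set.preimage] using hnull c
  have : NeZero μ := ⟨hμ⟩
  obtain ⟨x, hx⟩ := hall.exists
  exact hx _ rfl

/-- Lemma 1: if `T` is ergodic then `F = cyc p T` has no `p`-th root. -/
theorem stmt5
    {Y : Type*} [MeasurableSpace Y] {m : Measure Y} [SigmaFinite m] (hm : m ≠ 0)
    (T : Y ≃ᵐ Y) (hT : MeasurePreserving T m m) (hTerg : ErgodicAE T m)
    (p : ℕ) (hp : 2 ≤ p) :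
    ¬ ∃ R : (Y × ZMod p) ≃ᵐ (Y × ZMod p),
        MeasurePreserving R (m.prod (unif p)) (m.prod (unif p)) ∧
        (⇑R)^[p] =ᵐ[m.prod (unif p)] cyc p T := by
  rintro ⟨R, hR, hRp⟩
  have : NeZero p := ⟨by omega⟩
  have : Fact (1 < p) := ⟨hp⟩
  set d : Y × ZMod p → ZMod p := fun x => (R x).2 - x.2 with hd
  have hdm : Measurable d :=
    (measurable_snd.comp R.measurable).sub measurable_snd
  have hdF : ∀ᵐ x ∂m.prod (unif p), d (cyc p T x) = d x := by
    filter_upwards [hRp, hR.quasiMeasurePreserving.ae hRp] with x hx hRx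
    have hcomm : R (cyc p T x) = cyc p T (R x) := by
      rw [← hx, ← hRx]
      exact (Function.Commute.self_iterate R p).eq x
    simp only [hd, hcomm, snd_cyc]
    ring
  have hfib : ∀ᵐ y ∂m, d (T y, 1) = d (y, 1) ∧ ∀ z, d (y, z) = d (y, 1) := by
    filter_upwards [ae_prod_unif_iff.1 hdF] with y hy
    have hconst : ∀ z, d (y, z) = d (y, 1) :=
      eq_of_forall_ne_zero_add_one (g := fun z => d (y, z)) fun z hz => by
        simpa [cyc, hz] using hy z
    refine ⟨?_, hconst⟩
    rw [← hconst 0, ← hy 0]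
    simp [cyc]
  obtain ⟨c, hc⟩ := hTerg.exists_ae_eq_const hm (g := fun y => d (y, 1))
    (hdm.comp measurable_prodMk_right) (hfib.mono fun y hy => hy.1)
  have hdc : ∀ᵐ x ∂m.prod (unif p), d x = c := by
    rw [ae_prod_unif_iff]
    filter_upwards [hfib, hc] with y hy hyc z
    rw [hy.2 z, hyc]
  have hiter : ∀ n : ℕ, ∀ᵐ x ∂m.prod (unif p), (R^[n] x).2 = x.2 + n * c := by
    intro n
    induction n with
    | zero => simp
    | succ n ih =>
      filter_upwards [ih, (hR.iterate n).quasiMeasurePreserving.ae hdc] with x hx hxc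
      rw [Function.iterate_succ_apply', sub_eq_iff_eq_add.1 hxc, hx]
      push_cast
      ring
  have hfalse : ∀ᵐ x ∂m.prod (unif p), False := by
    filter_upwards [hiter p, hRp] with x hx hxF
    rw [hxF, snd_cyc] at hx
    simp at hx
  have : NeZero m := ⟨hm⟩
  obtain ⟨y, hy⟩ := (ae_prod_unif_iff.1 hfalse).exists
  exact hy 0
end

section
/- Let W be an invertible measure-preserving transformation of a σ-finite measure space (X, μ), and let Y₀, …, Y_{p−1} (p ≥ 2) be pairwise disjoint measurable sets of positive measure whose union is conull in X, such that: each Y_i is invariant under W^p up to μ-null sets, W^p is ergodic with respect to μ restricted to Y_i for every i, and W maps Y_i onto Y_{i+1 mod p} up to μ-null sets (i.e. W⁻¹(Y_{i+1 mod p}) = Y_i up to null sets). Then W has no p-th root: there is no invertible measure-preserving transformation R of (X, μ) with R^p = W μ-almost everywhere. -/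
open MeasureTheory Filter
open scoped symmDiff

/-- If two maps preserve null sets and commute almost everywhere, then so do the first map and
every iterate of the second. -/
lemma ae_comm_iterate {X : Type*} [MeasurableSpace X] {μ : Measure X} {f g : X → X}
    (hg : Measure.QuasiMeasurePreserving g μ μ) (h : ∀ᵐ x ∂μ, f (g x) = g (f x)) (n : ℕ) :
    ∀ᵐ x ∂μ, f (g^[n] x) = g^[n] (f x) := by
  induction n with
  | zero => simp
  | succ n ih =>
    filter_upwards [h, hg.ae ih] with x hx hn
    rw [Function.iterate_succ_apply, Function.iterate_succ_apply, hn, hx]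

/-- A map sending each set of a family almost everywhere into another one has iterates doing the
same along the iterated index map. -/
lemma ae_mem_iterate {X ι : Type*} [MeasurableSpace X] {μ : Measure X} {f : X → X}
    (hf : Measure.QuasiMeasurePreserving f μ μ) {Y : ι → Set X} {σ : ι → ι}
    (h : ∀ i, ∀ᵐ x ∂μ, x ∈ Y i → f x ∈ Y (σ i)) (n : ℕ) (i : ι) :
    ∀ᵐ x ∂μ, x ∈ Y i → f^[n] x ∈ Y (σ^[n] i) := by
  induction n generalizing i with
  | zero => simp
  | succ n ih =>
    filter_upwards [h i, hf.ae (ih (σ i))] with x hx hn hi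
    exact hn (hx hi)

/-- The successor map on `ZMod p` has no `p`-th root when `p ≥ 2`. -/
lemma ZMod.not_iterate_eq_add_one {p : ℕ} (hp : 2 ≤ p) (σ : ZMod p → ZMod p) :
    ¬ ∀ i, σ^[p] i = i + 1 := by
  intro h
  have : Fact (1 < p) := ⟨hp⟩
  have hσ (i : ZMod p) : σ (i + 1) = σ i + 1 := by
    rw [← h i, ← h (σ i), ← Function.iterate_succ_apply, Function.iterate_succ_apply']
  have hnat (n : ℕ) : σ n = σ 0 + n := by
    induction n with
    | zero => simp
    | succ n ih => push_cast; rw [hσ, ih]; ring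
  have htrans (i : ZMod p) : σ i = σ 0 + i := by
    have : NeZero p := ⟨by omega⟩
    simpa using hnat i.val
  have hiter (n : ℕ) : σ^[n] 0 = n * σ 0 := by
    induction n with
    | zero => simp
    | succ n ih => rw [Function.iterate_succ_apply', ih, htrans]; push_cast; ring
  have h0 := h 0
  rw [hiter p] at h0
  simp at h0

/-- an invertible measure-preserving `W` whose `p`-th power has exactly `p`
ergodic components `Y₀, …, Y_{p-1}` cyclically permuted by `W` has no `p`-th root. -/
theorem stmt6
    {X : Type*} [MeasurableSpace X] {μ : Measure X} [SigmaFinite μ]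
    (W : X ≃ᵐ X) (hW : MeasurePreserving W μ μ)
    (p : ℕ) (hp : 2 ≤ p)
    (Y : ZMod p → Set X)
    (hmeas : ∀ i, MeasurableSet (Y i))
    (hdisj : ∀ i j, i ≠ j → Disjoint (Y i) (Y j))
    (hpos : ∀ i, 0 < μ (Y i))
    (hconull : μ (⋃ i, Y i)ᶜ = 0)
    (hinv : ∀ i, μ (((⇑W)^[p] ⁻¹' Y i) ∆ Y i) = 0)
    (herg : ∀ i, ErgodicAE ((⇑W)^[p]) (μ.restrict (Y i)))
    (hcyc : ∀ i, μ ((⇑W ⁻¹' Y (i + 1)) ∆ Y i) = 0) :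
    ¬ ∃ R : X ≃ᵐ X, MeasurePreserving R μ μ ∧ (⇑R)^[p] =ᵐ[μ] ⇑W := by
  rintro ⟨R, hR, hroot⟩
  have hcomm : ∀ᵐ x ∂μ, R (W x) = W (R x) := by
    filter_upwards [hroot, hR.quasiMeasurePreserving.ae hroot] with x hx hRx
    rw [← hx, ← hRx, ← Function.iterate_succ_apply, Function.iterate_succ_apply']
  have hcommp := ae_comm_iterate hW.quasiMeasurePreserving hcomm p
  have hexists (i : ZMod p) : ∃ j, ∀ᵐ x ∂μ, x ∈ Y i → R x ∈ Y j := by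
    by_contra hno
    rw [not_exists] at hno
    have hnull (j : ZMod p) : ∀ᵐ x ∂μ, x ∈ Y i → R x ∉ Y j := by
      have hinvj : ∀ᵐ x ∂μ, W^[p] x ∈ Y j ↔ x ∈ Y j :=
        eventuallyEq_set.1 (measure_symmDiff_eq_zero_iff.1 (hinv j))
      have hpre : (W^[p]) ⁻¹' (R ⁻¹' Y j) =ᵐ[μ] R ⁻¹' Y j := by
        refine eventuallyEq_set.2 ?_
        filter_upwards [hcommp, hR.quasiMeasurePreserving.ae hinvj] with x hx hj
        simpa [hx] using hj
      rcases herg i (R ⁻¹' Y j) (R.measurable (hmeas j))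
        (measure_symmDiff_eq_zero_iff.2 (ae_restrict_of_ae hpre)) with h | h
      · exact (ae_restrict_iff' (hmeas i)).1 (measure_eq_zero_iff_ae_notMem.1 h)
      · exact absurd ((ae_restrict_iff' (hmeas i)).1 (mem_ae_iff.2 h)) (hno j)
    have : NeZero p := ⟨by omega⟩
    have hcover : ∀ᵐ x ∂μ, x ∈ ⋃ j, Y j := mem_ae_iff.2 hconull
    refine (hpos i).ne' (measure_eq_zero_iff_ae_notMem.2 ?_)
    filter_upwards [ae_all_iff.2 hnull, hR.quasiMeasurePreserving.ae hcover] with x hx hRx hi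
    obtain ⟨j, hj⟩ := Set.mem_iUnion.1 hRx
    exact hx j hi hj
  choose σ hσ using hexists
  refine ZMod.not_iterate_eq_add_one hp σ fun i => ?_
  by_contra hne
  have hstep : ∀ᵐ x ∂μ, W x ∈ Y (i + 1) ↔ x ∈ Y i :=
    eventuallyEq_set.1 (measure_symmDiff_eq_zero_iff.1 (hcyc i))
  refine (hpos i).ne' (measure_eq_zero_iff_ae_notMem.2 ?_)
  filter_upwards [hstep, hroot, ae_mem_iterate hR.quasiMeasurePreserving hσ p i] with x hx hr hm hi
  exact Set.disjoint_left.1 (hdisj _ _ hne) (hm hi) (hr ▸ hx.2 hi)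
end

section
/- Let σ and τ be finite Borel measures on the unit circle 𝕋 = {z ∈ ℂ : |z| = 1}, let (m_i) be a strictly increasing sequence of natural numbers, and let a, b ∈ ℂ with a ≠ b. Suppose that for every Borel set A ⊆ 𝕋: ∫_A z^{m_i} dσ(z) → a · σ(A) and ∫_A z^{m_i} dτ(z) → b · τ(A) as i → ∞. Then σ and τ are mutually singular. -/
open MeasureTheory Filter

noncomputable instance : MeasurableSpace Circle := borel Circle
instance : BorelSpace Circle := ⟨rfl⟩

/-- If uniformly bounded functions have averages over every measurable set converging to the
constant `c`, then their integrals against every integrable weight converge accordingly. -/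
theorem tendsto_integral_smul_of_tendsto_setIntegral {α : Type*} [MeasurableSpace α]
    {μ : Measure α} {ι : Type*} {l : Filter ι} {F : ι → α → ℂ} {C : ℝ} {c : ℂ}
    (hF : ∀ i, AEStronglyMeasurable (F i) μ) (hC : ∀ i x, ‖F i x‖ ≤ C)
    (h : ∀ A : Set α, MeasurableSet A →
      Tendsto (fun i => ∫ x in A, F i x ∂μ) l (nhds (c * ((μ A).toReal : ℂ))))
    {g : α → ℝ} (hg : Integrable g μ) :
    Tendsto (fun i => ∫ x, g x • F i x ∂μ) l (nhds ((∫ x, g x ∂μ) • c)) := by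
  have hint {f : α → ℝ} (hf : Integrable f μ) (i : ι) : Integrable (fun x => f x • F i x) μ :=
    hf.smul_bdd C (hF i) (Eventually.of_forall (hC i))
  refine Integrable.induction
    (fun g : α → ℝ => Tendsto (fun i => ∫ x, g x • F i x ∂μ) l (nhds ((∫ x, g x ∂μ) • c)))
    ?_ ?_ ?_ ?_ hg
  · intro r s hs _
    have key (i : ι) : ∫ x, s.indicator (fun _ => r) x • F i x ∂μ = r • ∫ x in s, F i x ∂μ := by
      rw [← integral_smul, ← integral_indicator hs]
      congr 1 with x
      by_cases hx : x ∈ s <;> simp [hx]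
    simp_rw [key]
    convert (h s hs).const_smul r using 2
    rw [integral_indicator hs]
    simp [Measure.real]
    ring
  · intro f g _ hf hg ihf ihg
    have key (i : ι) : ∫ x, (f + g) x • F i x ∂μ
        = ∫ x, f x • F i x ∂μ + ∫ x, g x • F i x ∂μ := by
      rw [← integral_add (hint hf i) (hint hg i)]
      simp [add_mul]
    simp_rw [key]
    rw [integral_add' hf hg, add_smul]
    exact ihf.add ihg
  · refine Equicontinuous.isClosed_setOfPred_tendsto
      (F := fun i (f : α →₁[μ] ℝ) => ∫ x, f x • F i x ∂μ)
      (f := fun f : α →₁[μ] ℝ => (∫ x, f x ∂μ) • c) ?_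
      (continuous_integral.smul continuous_const)
    refine Metric.equicontinuous_of_continuity_modulus (fun t => C * t) ?_ _ ?_
    · simpa using (continuous_const_mul C).tendsto 0
    · intro f g i
      have hf := L1.integrable_coeFn f
      have hg := L1.integrable_coeFn g
      rw [dist_eq_norm, dist_eq_norm, L1.norm_eq_integral_norm,
        ← integral_sub (hint hf i) (hint hg i), ← integral_const_mul]
      refine norm_integral_le_of_norm_le ((L1.integrable_coeFn (f - g)).norm.const_mul C) ?_
      filter_upwards [Lp.coeFn_sub f g] with x hx
      rw [hx, ← sub_smul, norm_smul, mul_comm, Pi.sub_apply]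
      gcongr
      exact hC i x
  · intro f g hfg _ ih
    rw [← integral_congr_ae hfg]
    refine ih.congr fun i => integral_congr_ae ?_
    filter_upwards [hfg] with x hx
    rw [hx]

/-- if `z^{m i}` converges weakly to the constant `a` in `L²(σ)` and to the
constant `b ≠ a` in `L²(τ)` (expressed via set integrals), then the finite measures `σ` and
`τ` on the unit circle are mutually singular. -/
theorem stmt14
    (σ τ : Measure Circle) [IsFiniteMeasure σ] [IsFiniteMeasure τ]
    (m : ℕ → ℕ) (hm : StrictMono m)
    (a b : ℂ) (hab : a ≠ b)
    (hσ : ∀ A : Set Circle, MeasurableSet A →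
      Tendsto (fun i => ∫ z in A, ((z : ℂ) ^ (m i)) ∂σ) atTop
        (nhds (a * ((σ A).toReal : ℂ))))
    (hτ : ∀ A : Set Circle, MeasurableSet A →
      Tendsto (fun i => ∫ z in A, ((z : ℂ) ^ (m i)) ∂τ) atTop
        (nhds (b * ((τ A).toReal : ℂ)))) :
    σ ⟂ₘ τ := by
  by_contra hsing
  obtain ⟨ε, hε, E, hE, hpos, hle⟩ := Measure.exists_positive_of_not_mutuallySingular σ τ hsing
  have hac : τ.restrict E ≪ σ := by
    refine Measure.AbsolutelyContinuous.mk fun A hA hA0 => ?_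
    rw [Measure.restrict_apply hA]
    have := (hle A hA).trans (measure_mono Set.inter_subset_left)
    simpa [hA0, hε.ne'] using this
  have hlim := tendsto_integral_smul_of_tendsto_setIntegral
    (F := fun i (z : Circle) => (z : ℂ) ^ m i) (C := 1)
    (fun i => (by fun_prop : Continuous fun z : Circle => (z : ℂ) ^ m i).aestronglyMeasurable)
    (fun i z => by simp [Circle.norm_coe]) hσ (Measure.integrable_toReal_rnDeriv (μ := τ.restrict E) (ν := σ))
  simp_rw [integral_rnDeriv_smul hac] at hlim
  have heq := tendsto_nhds_unique hlim (hτ E hE)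
  have hne : ((τ E).toReal : ℂ) ≠ 0 :=
    Complex.ofReal_ne_zero.2 (ENNReal.toReal_pos hpos.ne' (measure_ne_top τ E)).ne'
  rw [Measure.integral_toReal_rnDeriv hac, Measure.real, Measure.restrict_apply_univ,
    Complex.real_smul, mul_comm] at heq
  exact hab (mul_right_cancel₀ hne heq)
end

section
/- (Root-free part of Theorem 2) Let W be an invertible measure-preserving transformation of a σ-finite measure space (X, μ) with the following property: for every prime p there exist pairwise disjoint measurable sets Y₀, …, Y_{p−1} of positive measure whose union is conull, each invariant under W^p up to μ-null sets, with W^p ergodic with respect to μ restricted to each Y_i, and with W⁻¹(Y_{i+1 mod p}) = Y_i up to μ-null sets for every i (i.e. W^p has exactly p ergodic components, cyclically permuted by W). Then W has no roots: for every integer n ≥ 2 there is no invertible measure-preserving transformation R of (X, μ) with R^n = W μ-almost everywhere. -/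
open MeasureTheory Filter
open scoped symmDiff

/-- If `S` almost everywhere commutes with `W`, it almost everywhere commutes with the iterates
of `W`. -/
lemma comp_iterate_ae_comm {X : Type*} [MeasurableSpace X] {μ : Measure X} {S W : X → X}
    (hW : MeasurePreserving W μ μ) (hSW : S ∘ W =ᵐ[μ] W ∘ S) (k : ℕ) :
    S ∘ W^[k] =ᵐ[μ] W^[k] ∘ S := by
  induction k with
  | zero => exact EventuallyEq.rfl
  | succ k ih =>
    filter_upwards [hW.quasiMeasurePreserving.ae ih, hSW] with x hx hx'
    simp only [Function.comp_apply, Function.iterate_succ] at hx hx' ⊢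
    rw [hx, hx']

/-- Almost everywhere equal maps have almost everywhere equal preimages. -/
lemma preimage_ae_eq_of_ae_eq {X : Type*} [MeasurableSpace X] {μ : Measure X} {f g : X → X}
    (h : f =ᵐ[μ] g) (B : Set X) : f ⁻¹' B =ᵐ[μ] g ⁻¹' B := by
  filter_upwards [h] with x hx
  exact congrArg B hx

/-- A set of positive measure that is invariant under `f` almost contains one of the ergodic
components of `f`. -/
lemma exists_ergodic_component_ae_le {X ι : Type*} [Countable ι] [MeasurableSpace X]
    {μ : Measure X} {f : X → X} {Y : ι → Set X}
    (hcov : μ (⋃ i, Y i)ᶜ = 0) (herg : ∀ i, ErgodicAE f (μ.restrict (Y i)))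
    {A : Set X} (hA : MeasurableSet A) (hpos : 0 < μ A) (hinv : f ⁻¹' A =ᵐ[μ] A) :
    ∃ i, Y i ≤ᵐ[μ] A := by
  have hinv0 : μ ((f ⁻¹' A) ∆ A) = 0 := measure_symmDiff_eq_zero_iff.2 hinv
  by_contra! hne
  refine hpos.ne' (measure_mono_null (t := (⋃ i, A ∩ Y i) ∪ (⋃ i, Y i)ᶜ) ?_ ?_)
  · intro x hx
    by_cases hxY : x ∈ ⋃ i, Y i
    · left
      rw [← Set.inter_iUnion]
      exact ⟨hx, hxY⟩
    · exact Or.inr hxY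
  · refine measure_union_null (measure_iUnion_null fun i => ?_) hcov
    rcases herg i A hA (Measure.restrict_le_self.absolutelyContinuous hinv0) with h | h
    · rwa [Measure.restrict_apply hA] at h
    · rw [Measure.restrict_apply hA.compl] at h
      refine absurd (ae_le_set.2 ?_) (hne i)
      rwa [Set.sdiff_eq, Set.inter_comm]

/-- A map `W` that cyclically permutes `p` ergodic components of `W^p` has no `p`-th root: such a
root would act on the components as a translation of `ZMod p`, so that its `p`-th power would fix
each of them. -/
lemma not_exists_root_of_cyclic_components {X : Type*} [MeasurableSpace X] {μ : Measure X}
    {p : ℕ} (hp : p.Prime) {S W : X → X}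
    (hW : MeasurePreserving W μ μ) (hS : MeasurePreserving S μ μ) (hSW : S^[p] =ᵐ[μ] W)
    {Y : ZMod p → Set X} (hYm : ∀ i, MeasurableSet (Y i))
    (hdisj : ∀ i j, i ≠ j → Disjoint (Y i) (Y j)) (hpos : ∀ i, 0 < μ (Y i))
    (hcov : μ (⋃ i, Y i)ᶜ = 0) (hinv : ∀ i, W^[p] ⁻¹' Y i =ᵐ[μ] Y i)
    (herg : ∀ i, ErgodicAE (W^[p]) (μ.restrict (Y i)))
    (hcyc : ∀ i, W ⁻¹' Y (i + 1) =ᵐ[μ] Y i) : False := by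
  have : Fact p.Prime := ⟨hp⟩
  have hcomm : S ∘ W =ᵐ[μ] W ∘ S := by
    filter_upwards [hSW, hS.quasiMeasurePreserving.ae hSW] with x hx hx'
    simp only [Function.comp_apply]
    rw [← hx, ← hx', ← Function.iterate_succ_apply' S, ← Function.iterate_succ_apply S]
  obtain ⟨c, hc⟩ : ∃ c, Y c ≤ᵐ[μ] S ⁻¹' Y 0 := by
    refine exists_ergodic_component_ae_le hcov herg (hS.measurable (hYm 0)) ?_ ?_
    · rw [hS.measure_preimage (hYm 0).nullMeasurableSet]
      exact hpos 0
    · exact (preimage_ae_eq_of_ae_eq (comp_iterate_ae_comm hW hcomm p) (Y 0)).trans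
        (hS.quasiMeasurePreserving.preimage_ae_eq (hinv 0))
  have hstep : ∀ i, Y (c + (i + 1)) ≤ᵐ[μ] S ⁻¹' Y (i + 1) → Y (c + i) ≤ᵐ[μ] S ⁻¹' Y i := by
    intro i hi
    have hci := hcyc (c + i)
    rw [add_assoc] at hci
    have hWS : W ⁻¹' (S ⁻¹' Y (i + 1)) =ᵐ[μ] S ⁻¹' Y i :=
      (preimage_ae_eq_of_ae_eq hcomm _).trans (hS.quasiMeasurePreserving.preimage_ae_eq (hcyc i))
    exact (hci.symm.trans_le (hW.quasiMeasurePreserving.preimage_mono_ae hi)).trans_eq hWS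
  have hneg : ∀ k : ℕ, Y (c + -(k : ZMod p)) ≤ᵐ[μ] S ⁻¹' Y (-(k : ZMod p)) := by
    intro k
    induction k with
    | zero => simpa using hc
    | succ k ih =>
      apply hstep
      have : -((k + 1 : ℕ) : ZMod p) + 1 = -(k : ZMod p) := by push_cast; ring
      rwa [this]
  have htrans : ∀ i, Y (c + i) ≤ᵐ[μ] S ⁻¹' Y i := by
    intro i
    simpa using hneg (-i).val
  have hiter : ∀ k : ℕ, Y (k * c) ≤ᵐ[μ] S^[k] ⁻¹' Y 0 := by
    intro k
    induction k with
    | zero => simpa using EventuallyLE.rfl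
    | succ k ih =>
      have hk : ((k + 1 : ℕ) : ZMod p) * c = c + k * c := by push_cast; ring
      rw [hk, Function.iterate_succ, Set.preimage_comp]
      exact (htrans _).trans (hS.quasiMeasurePreserving.preimage_mono_ae ih)
  have hfix : Y 0 ≤ᵐ[μ] Y (-1) := by
    have hW0 := hcyc (-1)
    rw [neg_add_cancel] at hW0
    have hp0 := hiter p
    rw [CharP.cast_eq_zero, zero_mul] at hp0
    exact (hp0.trans_eq (preimage_ae_eq_of_ae_eq hSW (Y 0))).trans_eq hW0
  have hne : (0 : ZMod p) ≠ -1 := (neg_ne_zero.2 one_ne_zero).symm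
  rw [ae_le_set, (hdisj 0 (-1) hne).sdiff_eq_left] at hfix
  exact (hpos 0).ne' hfix

/-- root-free part of Theorem 2: if, for every prime `p`, the power `W^p`
has exactly `p` ergodic components `Y₀, …, Y_{p-1}` (pairwise disjoint, positive measure,
conull union, invariant under `W^p`, with `W^p` ergodic on each) cyclically permuted by `W`,
then `W` has no roots of any degree `n ≥ 2`. -/
theorem stmt17
    {X : Type*} [MeasurableSpace X] {μ : Measure X} [SigmaFinite μ]
    (W : X ≃ᵐ X) (hW : MeasurePreserving W μ μ)
    (hcomp : ∀ p : ℕ, p.Prime →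
      ∃ Y : ZMod p → Set X,
        (∀ i, MeasurableSet (Y i)) ∧
        (∀ i j, i ≠ j → Disjoint (Y i) (Y j)) ∧
        (∀ i, 0 < μ (Y i)) ∧
        μ (⋃ i, Y i)ᶜ = 0 ∧
        (∀ i, μ (((⇑W)^[p] ⁻¹' Y i) ∆ Y i) = 0) ∧
        (∀ i, ErgodicAE ((⇑W)^[p]) (μ.restrict (Y i))) ∧
        (∀ i, μ ((⇑W ⁻¹' Y (i + 1)) ∆ Y i) = 0)) :
    ∀ n : ℕ, 2 ≤ n →
      ¬ ∃ R : X ≃ᵐ X, MeasurePreserving R μ μ ∧ (⇑R)^[n] =ᵐ[μ] ⇑W := by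
  rintro n hn ⟨R, hR, hRW⟩
  obtain ⟨p, hp, m, rfl⟩ := Nat.exists_prime_and_dvd (show n ≠ 1 by omega)
  obtain ⟨Y, hYm, hdisj, hpos, hcov, hinv, herg, hcyc⟩ := hcomp p hp
  rw [mul_comm, Function.iterate_mul] at hRW
  exact not_exists_root_of_cyclic_components hp hW (hR.iterate m) hRW hYm hdisj hpos hcov
    (fun i => measure_symmDiff_eq_zero_iff.1 (hinv i)) herg
    (fun i => measure_symmDiff_eq_zero_iff.1 (hcyc i))
end
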